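/- arXiv:2207.10372 — 4 statements merged into one kernel-verified Lean document; each statement's English description precedes it below -/
import Mathlib

section
/- Suppose HM (the product of H and M) is injective and 0 < τ < (−1 + √5)/(2‖H‖²‖M‖²). Then there is no pair (λ, y) with λ ∈ ℂ, |λ| ≥ 1, y ∈ ℂ^{n_σ}, y ≠ 0, satisfying λ²(λ − 1)‖y‖² + τ‖HMy‖² = 0. -/
open Matrix

/-- Operator norm induced by the Euclidean norms. -/
noncomputable def opNorm {𝕜 : Type*} [RCLike 𝕜] {m n : ℕ} (A : Matrix (Fin m) (Fin n) 𝕜) : ℝ :=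
  ‖LinearMap.toContinuousLinearMap (Matrix.toEuclideanLin A)‖

/-- A root of `z³ - z² + t` with `0 < t` and `t² + t < 1` lies in the open unit disc. -/
lemma norm_lt_one_of_sq_mul_sub_one_add_eq_zero {z : ℂ} {t : ℝ} (ht : 0 < t)
    (ht' : t ^ 2 + t < 1) (h : z ^ 2 * (z - 1) + t = 0) : ‖z‖ < 1 := by
  by_contra! hz
  have hr : 1 ≤ z.re ^ 2 + z.im ^ 2 := by
    have h1 : 1 ≤ ‖z‖ ^ 2 := one_le_pow₀ hz
    rw [Complex.sq_norm, Complex.normSq_apply] at h1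
    nlinarith
  obtain ⟨a, b⟩ := z
  have hre := congrArg Complex.re h
  have him := congrArg Complex.im h
  simp [pow_two] at hre him hr
  have him' : b * (3 * a ^ 2 - b ^ 2 - 2 * a) = 0 := by linear_combination him
  rcases mul_eq_zero.mp him' with hb | hb
  · subst hb
    have hcubic : a ^ 2 * (a - 1) + t = 0 := by linear_combination hre
    have ha : 1 ≤ a ^ 2 := by linarith
    rcases le_or_gt 1 a with h1 | h1
    · nlinarith [mul_nonneg (sq_nonneg a) (sub_nonneg.mpr h1)]
    · have h2 : a ≤ -1 := by nlinarith
      nlinarith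
  · set d := 2 * a - 1 with hd
    have hrd : a * a + b * b = d ^ 2 + d := by
      rw [hd]; linear_combination -hb
    have htd : t = d * (d ^ 2 + d) := by
      rw [hd]; linear_combination hre + (1 - 3 * a) * hb
    have hd1 : 1 ≤ d ^ 2 + d := by linarith
    have hd0 : 0 < d := by
      by_contra! h0
      nlinarith
    have htd' : d ≤ t := by nlinarith
    nlinarith

lemma star_dotProduct_self_eq_re_add_im {n : ℕ} (z : Fin n → ℂ) :
    star z ⬝ᵥ z = (((fun i => (z i).re) ⬝ᵥ (fun i => (z i).re) +
      (fun i => (z i).im) ⬝ᵥ (fun i => (z i).im) : ℝ) : ℂ) := by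
  simp only [dotProduct, ← Finset.sum_add_distrib, Complex.ofReal_sum]
  refine Finset.sum_congr rfl fun i _ => ?_
  apply Complex.ext <;> simp
  ring

lemma re_map_ofReal_mulVec {m n : ℕ} (A : Matrix (Fin m) (Fin n) ℝ) (y : Fin n → ℂ) :
    (fun i => ((A.map Complex.ofReal *ᵥ y) i).re) = A *ᵥ fun j => (y j).re := by
  ext i
  simp [mulVec, dotProduct]

lemma im_map_ofReal_mulVec {m n : ℕ} (A : Matrix (Fin m) (Fin n) ℝ) (y : Fin n → ℂ) :
    (fun i => ((A.map Complex.ofReal *ᵥ y) i).im) = A *ᵥ fun j => (y j).im := by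
  ext i
  simp [mulVec, dotProduct]

lemma mulVec_dotProduct_mulVec_le_opNorm {m n : ℕ} (A : Matrix (Fin m) (Fin n) ℝ)
    (x : Fin n → ℝ) : (A *ᵥ x) ⬝ᵥ (A *ᵥ x) ≤ opNorm A ^ 2 * (x ⬝ᵥ x) := by
  have hsq (k : ℕ) (v : Fin k → ℝ) : v ⬝ᵥ v = ‖WithLp.toLp 2 v‖ ^ 2 := by
    rw [EuclideanSpace.real_norm_sq_eq]
    simp [dotProduct, pow_two]
  rw [hsq, hsq, ← mul_pow]
  have h := (LinearMap.toContinuousLinearMap (Matrix.toEuclideanLin A)).le_opNorm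
    (WithLp.toLp 2 x)
  exact pow_le_pow_left₀ (norm_nonneg _) h 2

/-- the eigenvalue equation of the shifted one-step one-shot method with
`B = 0` has no solution `|λ| ≥ 1` when `τ < (−1+√5)/(2‖H‖²‖M‖²)`. -/
theorem shifted_one_step_one_shot_B_eq_zero
    {nu nσ nf : ℕ}
    (M : Matrix (Fin nu) (Fin nσ) ℝ) (H : Matrix (Fin nf) (Fin nu) ℝ)
    (hInj : Function.Injective fun x : Fin nσ → ℝ => (H * M) *ᵥ x)
    (τ : ℝ) (hτ : 0 < τ)
    (hτlt : τ < (-1 + Real.sqrt 5) / (2 * opNorm H ^ 2 * opNorm M ^ 2)) :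
    ¬ ∃ (lam : ℂ) (y : Fin nσ → ℂ), 1 ≤ ‖lam‖ ∧ y ≠ 0 ∧
      lam ^ 2 * (lam - 1) * (star y ⬝ᵥ y) +
        (τ : ℂ) * (star (((H * M).map Complex.ofReal) *ᵥ y) ⬝ᵥ
          (((H * M).map Complex.ofReal) *ᵥ y)) = 0 := by
  rintro ⟨lam, y, hlam, hy, heq⟩
  set u : Fin nσ → ℝ := fun i => (y i).re with hu
  set v : Fin nσ → ℝ := fun i => (y i).im with hv
  have hbound (x : Fin nσ → ℝ) : ((H * M) *ᵥ x) ⬝ᵥ ((H * M) *ᵥ x) ≤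
      opNorm H ^ 2 * opNorm M ^ 2 * (x ⬝ᵥ x) := by
    rw [← mulVec_mulVec, mul_assoc]
    exact (mulVec_dotProduct_mulVec_le_opNorm H _).trans
      (mul_le_mul_of_nonneg_left (mulVec_dotProduct_mulVec_le_opNorm M x) (sq_nonneg _))
  have hnonneg {k : ℕ} (x : Fin k → ℝ) : 0 ≤ x ⬝ᵥ x :=
    Finset.sum_nonneg fun i _ => mul_self_nonneg (x i)
  have huv : u ≠ 0 ∨ v ≠ 0 := by
    by_contra! h
    exact hy (funext fun i => Complex.ext (congrFun h.1 i) (congrFun h.2 i))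
  have hpos {k : ℕ} {x : Fin k → ℝ} (hx : x ≠ 0) : 0 < x ⬝ᵥ x :=
    (hnonneg x).lt_of_ne fun h => hx (dotProduct_self_eq_zero.mp h.symm)
  have hne {x : Fin nσ → ℝ} (hx : x ≠ 0) : (H * M) *ᵥ x ≠ 0 := fun h =>
    hx (hInj (by simpa using h))
  rw [star_dotProduct_self_eq_re_add_im, star_dotProduct_self_eq_re_add_im,
    re_map_ofReal_mulVec, im_map_ofReal_mulVec, ← hu, ← hv] at heq
  set S : ℝ := u ⬝ᵥ u + v ⬝ᵥ v with hS
  set T : ℝ := ((H * M) *ᵥ u) ⬝ᵥ ((H * M) *ᵥ u) + ((H * M) *ᵥ v) ⬝ᵥ ((H * M) *ᵥ v) with hT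
  have hS0 : 0 < S := by
    rcases huv with h | h
    · exact add_pos_of_pos_of_nonneg (hpos h) (hnonneg v)
    · exact add_pos_of_nonneg_of_pos (hnonneg u) (hpos h)
  have hT0 : 0 < T := by
    rcases huv with h | h
    · exact add_pos_of_pos_of_nonneg (hpos (hne h)) (hnonneg _)
    · exact add_pos_of_nonneg_of_pos (hnonneg _) (hpos (hne h))
  set K : ℝ := opNorm H ^ 2 * opNorm M ^ 2 with hK
  have hTS : T ≤ K * S := by
    rw [hS, mul_add]
    exact add_le_add (hbound u) (hbound v)
  have hK0 : 0 < K := pos_of_mul_pos_left (hT0.trans_le hTS) hS0.le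
  have hτK : τ * K < (-1 + Real.sqrt 5) / 2 := by
    rw [mul_assoc, ← hK, lt_div_iff₀ (by positivity)] at hτlt
    linarith
  have ht0 : 0 < τ * T / S := by positivity
  have ht : τ * T / S < (-1 + Real.sqrt 5) / 2 := by
    refine lt_of_le_of_lt ?_ hτK
    rw [div_le_iff₀ hS0, mul_assoc]
    exact mul_le_mul_of_nonneg_left hTS hτ.le
  refine (norm_lt_one_of_sq_mul_sub_one_add_eq_zero (z := lam) ht0 ?_ ?_).not_ge hlam
  · nlinarith [Real.sq_sqrt (show (0 : ℝ) ≤ 5 by norm_num), Real.sqrt_nonneg 5]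
  · have hSC : (S : ℂ) ≠ 0 := Complex.ofReal_ne_zero.mpr hS0.ne'
    push_cast
    field_simp
    linear_combination heq
end

section
/- Consider the equation (λ − 1)‖y‖² + τ·⟨Mᵀ(λI − Bᵀ)⁻¹HᵀH(λI − B)⁻¹M y, y⟩ = 0 in the unknowns λ ∈ ℝ and y ∈ ℂ^{n_σ}, y ≠ 0. (i) For every τ > 0 this equation has no solution with λ > 1. (ii) If τ < 2/(‖H‖²‖M‖²·s(B)²), the equation has no solution with λ ≤ −1; moreover, if 0 < ‖B‖ < 1, the bound τ < 2(1 − ‖B‖)²/(‖H‖²‖M‖²) also suffices to exclude every solution with λ ≤ −1. -/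
open Matrix

/-- `s(T) = sup_{z ∈ ℂ, |z| ≥ 1} ‖(I − T/z)⁻¹‖`. -/
noncomputable def sSB {n : ℕ} (T : Matrix (Fin n) (Fin n) ℂ) : ℝ :=
  sSup {r : ℝ | ∃ z : ℂ, 1 ≤ ‖z‖ ∧
    r = opNorm ((1 : Matrix (Fin n) (Fin n) ℂ) - z⁻¹ • T)⁻¹}

open scoped Matrix.Norms.L2Operator

lemma opNorm_eq_l2_norm {𝕜 : Type*} [RCLike 𝕜] {m n : ℕ} (A : Matrix (Fin m) (Fin n) 𝕜) :
    opNorm A = ‖A‖ := rfl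

lemma l2_norm_toLp_mulVec_le {𝕜 : Type*} [RCLike 𝕜] {m n : ℕ} (A : Matrix (Fin m) (Fin n) 𝕜)
    (x : Fin n → 𝕜) : ‖WithLp.toLp 2 (A *ᵥ x)‖ ≤ ‖A‖ * ‖WithLp.toLp 2 x‖ :=
  A.l2_opNorm_mulVec (WithLp.toLp 2 x)

lemma l2_norm_one_le (n : ℕ) : ‖(1 : Matrix (Fin n) (Fin n) ℂ)‖ ≤ 1 := by
  rw [← diagonal_one, l2_opNorm_diagonal]
  exact (pi_norm_le_iff_of_nonneg zero_le_one).2 fun i => by simp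

lemma norm_sq_toLp_eq_re_add_im {n : ℕ} (x : Fin n → ℂ) :
    ‖WithLp.toLp 2 x‖ ^ 2 =
      ‖WithLp.toLp 2 fun i => (x i).re‖ ^ 2 + ‖WithLp.toLp 2 fun i => (x i).im‖ ^ 2 := by
  simp only [EuclideanSpace.norm_sq_eq, ← Finset.sum_add_distrib]
  refine Finset.sum_congr rfl fun i _ => ?_
  simp only [Complex.sq_norm, Complex.normSq_apply, Real.norm_eq_abs, sq_abs]
  ring

lemma l2_norm_map_ofReal_le {m n : ℕ} (A : Matrix (Fin m) (Fin n) ℝ) :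
    ‖A.map Complex.ofReal‖ ≤ ‖A‖ := by
  refine ContinuousLinearMap.opNorm_le_bound _ (norm_nonneg A) fun x => ?_
  obtain ⟨x, rfl⟩ := WithLp.toLp_surjective 2 x
  change ‖WithLp.toLp 2 (A.map Complex.ofReal *ᵥ x)‖ ≤ ‖A‖ * ‖WithLp.toLp 2 x‖
  have hre : (fun i => ((A.map Complex.ofReal *ᵥ x) i).re) = A *ᵥ fun i => (x i).re := by
    ext i; simp [mulVec, dotProduct]
  have him : (fun i => ((A.map Complex.ofReal *ᵥ x) i).im) = A *ᵥ fun i => (x i).im := by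
    ext i; simp [mulVec, dotProduct]
  refine le_of_sq_le_sq ?_ (by positivity)
  rw [mul_pow, norm_sq_toLp_eq_re_add_im, norm_sq_toLp_eq_re_add_im x, hre, him, mul_add,
    ← mul_pow, ← mul_pow]
  gcongr <;> exact l2_norm_toLp_mulVec_le A _

lemma conjTranspose_map_ofReal {m n : ℕ} (A : Matrix (Fin m) (Fin n) ℝ) :
    (A.map Complex.ofReal)ᴴ = (A.map Complex.ofReal)ᵀ := by
  ext i j; simp

lemma star_dotProduct_self_eq {n : ℕ} (x : Fin n → ℂ) :
    star x ⬝ᵥ x = ((‖WithLp.toLp 2 x‖ ^ 2 : ℝ) : ℂ) := by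
  rw [dotProduct_comm, ← EuclideanSpace.inner_toLp_toLp, inner_self_eq_norm_sq_to_K]
  simp

lemma star_dotProduct_conjTranspose_mul_self {m n : ℕ} (K : Matrix (Fin m) (Fin n) ℂ)
    (y : Fin n → ℂ) :
    star y ⬝ᵥ ((Kᴴ * K) *ᵥ y) = ((‖WithLp.toLp 2 (K *ᵥ y)‖ ^ 2 : ℝ) : ℂ) := by
  rw [← star_dotProduct_self_eq, star_mulVec, ← mulVec_mulVec, dotProduct_mulVec]

/-- For `1 < lam` the eigenvalue expression is a sum of a positive and a nonnegative term. -/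
lemma add_norm_sq_ne_zero_of_one_lt {m n : ℕ} (K : Matrix (Fin m) (Fin n) ℂ) {lam τ : ℝ}
    (hτ : 0 < τ) (hlam : 1 < lam) {y : Fin n → ℂ} (hy : y ≠ 0) :
    (lam - 1) * ‖WithLp.toLp 2 y‖ ^ 2 + τ * ‖WithLp.toLp 2 (K *ᵥ y)‖ ^ 2 ≠ 0 := by
  have h : 0 < ‖WithLp.toLp 2 y‖ := by simpa using hy
  have := sub_pos.2 hlam
  positivity

lemma add_norm_sq_ne_zero_of_le_neg_one {m n : ℕ} (K : Matrix (Fin m) (Fin n) ℂ) {lam τ : ℝ}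
    (hτ : 0 < τ) (hK : τ * ‖K‖ ^ 2 < 2) (hlam : lam ≤ -1) {y : Fin n → ℂ} (hy : y ≠ 0) :
    (lam - 1) * ‖WithLp.toLp 2 y‖ ^ 2 + τ * ‖WithLp.toLp 2 (K *ᵥ y)‖ ^ 2 ≠ 0 := by
  have h : 0 < ‖WithLp.toLp 2 y‖ ^ 2 := by
    have : 0 < ‖WithLp.toLp 2 y‖ := by simpa using hy
    positivity
  refine ne_of_lt ?_
  calc (lam - 1) * ‖WithLp.toLp 2 y‖ ^ 2 + τ * ‖WithLp.toLp 2 (K *ᵥ y)‖ ^ 2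
      ≤ (lam - 1) * ‖WithLp.toLp 2 y‖ ^ 2 + τ * (‖K‖ * ‖WithLp.toLp 2 y‖) ^ 2 := by
        gcongr; exact l2_norm_toLp_mulVec_le K y
    _ = (lam - 1 + τ * ‖K‖ ^ 2) * ‖WithLp.toLp 2 y‖ ^ 2 := by ring
    _ < 0 := mul_neg_of_neg_of_pos (by linarith) h

lemma isUnit_one_sub_smul {n : ℕ} {T : Matrix (Fin n) (Fin n) ℂ}
    (hT : ∀ μ ∈ spectrum ℂ T, ‖μ‖ < 1) {w : ℂ} (hw : ‖w‖ ≤ 1) : IsUnit (1 - w • T) := by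
  rcases eq_or_ne w 0 with rfl | h0
  · simp
  have hmem : w⁻¹ ∉ spectrum ℂ T := fun hmem => by
    have := hT _ hmem
    rw [norm_inv] at this
    exact absurd this (not_lt.2 ((one_le_inv₀ (norm_pos_iff.2 h0)).2 hw))
  rw [spectrum.notMem_iff, Algebra.algebraMap_eq_smul_one] at hmem
  have := hmem.smul (Units.mk0 w h0)
  rwa [Units.smul_def, Units.val_mk0, smul_sub, smul_smul, mul_inv_cancel₀ h0, one_smul] at this

lemma l2_norm_inv_le_sSB {n : ℕ} {T : Matrix (Fin n) (Fin n) ℂ}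
    (hT : ∀ μ ∈ spectrum ℂ T, ‖μ‖ < 1) {z : ℂ} (hz : 1 ≤ ‖z‖) :
    ‖(1 - z⁻¹ • T)⁻¹‖ ≤ sSB T := by
  have hcont : ContinuousOn (fun w : ℂ => ‖(1 - w • T)⁻¹‖) (Metric.closedBall 0 1) := by
    intro w hw
    obtain ⟨u, hu⟩ := isUnit_one_sub_smul hT (mem_closedBall_zero_iff.1 hw)
    have hinv : ContinuousAt (fun w : ℂ => Ring.inverse (1 - w • T)) w := by
      refine ContinuousAt.comp (g := Ring.inverse) (f := fun w : ℂ => 1 - w • T) ?_ (by fun_prop)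
      rw [← hu]
      exact NormedRing.inverse_continuousAt u
    simp only [nonsing_inv_eq_ringInverse]
    exact hinv.norm.continuousWithinAt
  obtain ⟨C, hC⟩ := (isCompact_closedBall (0 : ℂ) 1).bddAbove_image hcont
  refine le_csSup ⟨C, ?_⟩ ⟨z, hz, rfl⟩
  rintro _ ⟨v, hv, rfl⟩
  refine hC ⟨v⁻¹, ?_, rfl⟩
  rw [mem_closedBall_zero_iff, norm_inv]
  exact inv_le_one_of_one_le₀ hv

lemma isUnit_smul_one_sub {n : ℕ} {T : Matrix (Fin n) (Fin n) ℂ}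
    (hT : ∀ μ ∈ spectrum ℂ T, ‖μ‖ < 1) {z : ℂ} (hz : 1 ≤ ‖z‖) :
    IsUnit (z • (1 : Matrix (Fin n) (Fin n) ℂ) - T) := by
  rw [← Algebra.algebraMap_eq_smul_one, ← spectrum.notMem_iff]
  exact fun h => absurd (hT z h) (not_lt.2 hz)

lemma l2_norm_resolvent_le_sSB {n : ℕ} {T : Matrix (Fin n) (Fin n) ℂ}
    (hT : ∀ μ ∈ spectrum ℂ T, ‖μ‖ < 1) {z : ℂ} (hz : 1 ≤ ‖z‖) :
    ‖(z • (1 : Matrix (Fin n) (Fin n) ℂ) - T)⁻¹‖ ≤ sSB T := by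
  have h0 : z ≠ 0 := norm_pos_iff.1 (zero_lt_one.trans_le hz)
  have hinv : ‖z⁻¹‖ ≤ 1 := by rw [norm_inv]; exact inv_le_one_of_one_le₀ hz
  have hfac : z • (1 : Matrix (Fin n) (Fin n) ℂ) - T = Units.mk0 z h0 • (1 - z⁻¹ • T) := by
    rw [Units.smul_def, Units.val_mk0, smul_sub, smul_smul, mul_inv_cancel₀ h0, one_smul]
  rw [hfac, inv_smul' _ _ ((isUnit_iff_isUnit_det _).1 (isUnit_one_sub_smul hT hinv)),
    Units.smul_def, norm_smul, Units.val_inv_eq_inv_val, Units.val_mk0]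
  exact (mul_le_of_le_one_left (norm_nonneg _) hinv).trans (l2_norm_inv_le_sSB hT hz)

lemma l2_norm_resolvent_le_inv_one_sub {n : ℕ} {T : Matrix (Fin n) (Fin n) ℂ}
    (hT : ∀ μ ∈ spectrum ℂ T, ‖μ‖ < 1) {z : ℂ} (hz : 1 ≤ ‖z‖) {b : ℝ} (hTb : ‖T‖ ≤ b)
    (hb : b < 1) : ‖(z • (1 : Matrix (Fin n) (Fin n) ℂ) - T)⁻¹‖ ≤ (1 - b)⁻¹ := by
  set R := (z • (1 : Matrix (Fin n) (Fin n) ℂ) - T)⁻¹ with hR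
  have h1 : R * (z • 1 - T) = 1 :=
    nonsing_inv_mul _ ((isUnit_iff_isUnit_det _).1 (isUnit_smul_one_sub hT hz))
  have h2 : z • R = 1 + R * T := by
    rw [← h1, mul_sub, mul_smul_comm, mul_one, sub_add_cancel]
  have h3 : ‖R‖ ≤ 1 + ‖R‖ * b := calc
    ‖R‖ ≤ ‖z‖ * ‖R‖ := le_mul_of_one_le_left (norm_nonneg _) hz
    _ = ‖1 + R * T‖ := by rw [← norm_smul, h2]
    _ ≤ ‖(1 : Matrix (Fin n) (Fin n) ℂ)‖ + ‖R * T‖ := norm_add_le _ _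
    _ ≤ 1 + ‖R‖ * b := by
      gcongr
      · exact l2_norm_one_le n
      · exact (norm_mul_le _ _).trans (by gcongr)
  rw [← one_div, le_div_iff₀ (sub_pos.2 hb)]
  linarith

lemma mul_sq_lt_of_lt_div {τ a c k : ℝ} (hτ : 0 < τ) (hk : 0 ≤ k) (hka : k ≤ a)
    (h : τ < c / a ^ 2) : τ * k ^ 2 < c := by
  have ha : 0 < a ^ 2 := (sq_nonneg a).lt_of_ne' fun h0 => by
    rw [h0, div_zero] at h
    exact absurd h hτ.not_gt
  calc τ * k ^ 2 ≤ τ * a ^ 2 := by gcongr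
    _ < c := (lt_div_iff₀ ha).1 h

/-- real eigenvalues for the shifted one-step one-shot method. -/
theorem shifted_one_step_one_shot_real_eigenvalues
    {nu nσ nf : ℕ}
    (B : Matrix (Fin nu) (Fin nu) ℝ) (M : Matrix (Fin nu) (Fin nσ) ℝ)
    (H : Matrix (Fin nf) (Fin nu) ℝ)
    (hρ : ∀ μ ∈ spectrum ℂ (B.map Complex.ofReal), ‖μ‖ < 1) :
    -- the eigenvalue-equation expression, for real λ and y ∈ ℂ^{nσ}
    let E : ℝ → (Fin nσ → ℂ) → ℝ → ℂ := fun lam y τ =>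
      ((lam : ℂ) - 1) * (star y ⬝ᵥ y) +
        (τ : ℂ) * (star y ⬝ᵥ
          (((M.map Complex.ofReal)ᵀ *
              ((lam : ℂ) • (1 : Matrix (Fin nu) (Fin nu) ℂ) - (B.map Complex.ofReal)ᵀ)⁻¹ *
              ((H.map Complex.ofReal)ᵀ * (H.map Complex.ofReal)) *
              ((lam : ℂ) • (1 : Matrix (Fin nu) (Fin nu) ℂ) - B.map Complex.ofReal)⁻¹ *
              M.map Complex.ofReal) *ᵥ y))
    -- (i) no real solution λ > 1, for every τ > 0
    (∀ τ : ℝ, 0 < τ → ∀ lam : ℝ, 1 < lam → ∀ y : Fin nσ → ℂ, y ≠ 0 → E lam y τ ≠ 0) ∧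
    -- (ii) no real solution λ ≤ −1 for τ < 2/(‖H‖²‖M‖²s(B)²)
    (∀ τ : ℝ, 0 < τ →
      τ < 2 / (opNorm H ^ 2 * opNorm M ^ 2 * sSB (B.map Complex.ofReal) ^ 2) →
      ∀ lam : ℝ, lam ≤ -1 → ∀ y : Fin nσ → ℂ, y ≠ 0 → E lam y τ ≠ 0) ∧
    -- moreover, if 0 < ‖B‖ < 1, the bound τ < 2(1−‖B‖)²/(‖H‖²‖M‖²) also suffices
    (0 < opNorm B → opNorm B < 1 →
      ∀ τ : ℝ, 0 < τ →
      τ < 2 * (1 - opNorm B) ^ 2 / (opNorm H ^ 2 * opNorm M ^ 2) →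
      ∀ lam : ℝ, lam ≤ -1 → ∀ y : Fin nσ → ℂ, y ≠ 0 → E lam y τ ≠ 0) := by
  intro E
  set K : ℝ → Matrix (Fin nf) (Fin nσ) ℂ := fun lam =>
    H.map Complex.ofReal * ((lam : ℂ) • 1 - B.map Complex.ofReal)⁻¹ * M.map Complex.ofReal with hK
  have hE : ∀ (lam : ℝ) (y : Fin nσ → ℂ) (τ : ℝ), E lam y τ =
      (((lam - 1) * ‖WithLp.toLp 2 y‖ ^ 2 + τ * ‖WithLp.toLp 2 (K lam *ᵥ y)‖ ^ 2 : ℝ) : ℂ) := by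
    intro lam y τ
    have hadj : (M.map Complex.ofReal)ᵀ *
        ((lam : ℂ) • (1 : Matrix (Fin nu) (Fin nu) ℂ) - (B.map Complex.ofReal)ᵀ)⁻¹ *
        ((H.map Complex.ofReal)ᵀ * (H.map Complex.ofReal)) *
        ((lam : ℂ) • (1 : Matrix (Fin nu) (Fin nu) ℂ) - B.map Complex.ofReal)⁻¹ *
        M.map Complex.ofReal = (K lam)ᴴ * K lam := by
      simp only [hK, conjTranspose_mul, conjTranspose_nonsing_inv, conjTranspose_sub,
        conjTranspose_smul, conjTranspose_one, conjTranspose_map_ofReal, Matrix.mul_assoc]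
      simp
    simp only [E]
    rw [hadj, star_dotProduct_conjTranspose_mul_self, star_dotProduct_self_eq]
    push_cast
    ring
  have hnormK : ∀ lam r : ℝ,
      ‖((lam : ℂ) • (1 : Matrix (Fin nu) (Fin nu) ℂ) - B.map Complex.ofReal)⁻¹‖ ≤ r →
      ‖K lam‖ ≤ ‖H‖ * ‖M‖ * r := by
    intro lam r hr
    calc ‖K lam‖ ≤ ‖H.map Complex.ofReal‖ * ‖((lam : ℂ) • (1 : Matrix (Fin nu) (Fin nu) ℂ) -
          B.map Complex.ofReal)⁻¹‖ * ‖M.map Complex.ofReal‖ :=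
        (l2_opNorm_mul _ _).trans (by gcongr; exact l2_opNorm_mul _ _)
      _ ≤ ‖H‖ * r * ‖M‖ := by
        have := (norm_nonneg _).trans hr
        gcongr <;> exact l2_norm_map_ofReal_le _
      _ = ‖H‖ * ‖M‖ * r := by ring
  have hone : ∀ lam : ℝ, lam ≤ -1 → 1 ≤ ‖(lam : ℂ)‖ := fun lam h => by
    rw [Complex.norm_real, Real.norm_eq_abs]
    exact le_abs.2 (.inr (by linarith))
  simp only [opNorm_eq_l2_norm]
  refine ⟨fun τ hτ lam hlam y hy => ?_, fun τ hτ hlt lam hlam y hy => ?_,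
    fun _ hB τ hτ hlt lam hlam y hy => ?_⟩ <;> rw [hE, Complex.ofReal_ne_zero]
  · exact add_norm_sq_ne_zero_of_one_lt _ hτ hlam hy
  · refine add_norm_sq_ne_zero_of_le_neg_one _ hτ ?_ hlam hy
    refine mul_sq_lt_of_lt_div hτ (norm_nonneg _)
      (hnormK lam _ (l2_norm_resolvent_le_sSB hρ (hone lam hlam))) ?_
    rwa [mul_pow, mul_pow]
  · refine add_norm_sq_ne_zero_of_le_neg_one _ hτ ?_ hlam hy
    refine mul_sq_lt_of_lt_div hτ (norm_nonneg _) (hnormK lam _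
      (l2_norm_resolvent_le_inv_one_sub hρ (hone lam hlam) (l2_norm_map_ofReal_le B) hB)) ?_
    rwa [mul_pow, mul_pow, inv_pow, ← div_eq_mul_inv, div_div_eq_mul_div]
end

section
/- For every k ≥ 1 the identity U_k T_k − X_k B^k + X_k = T_kᵀ HᵀH T_k holds, where T_k = I + B + ... + B^{k−1}, U_k = Σ_{i+j=k−1} (Bᵀ)^i HᵀH B^j, and X_k = Σ_{l=1}^{k−1} U_l (with X₁ = 0). Moreover U_k and X_k are symmetric: U_kᵀ = U_k and X_kᵀ = X_k. -/
open Matrix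

variable {nu nf : ℕ}

/-- `T_k = I + B + ... + B^{k−1}`. -/
noncomputable def Tmat (B : Matrix (Fin nu) (Fin nu) ℝ) (k : ℕ) :
    Matrix (Fin nu) (Fin nu) ℝ :=
  ∑ j ∈ Finset.range k, B ^ j

/-- `U_k = Σ_{i+j=k−1} (Bᵀ)^i HᵀH B^j`. -/
noncomputable def Umat (B : Matrix (Fin nu) (Fin nu) ℝ) (H : Matrix (Fin nf) (Fin nu) ℝ)
    (k : ℕ) : Matrix (Fin nu) (Fin nu) ℝ :=
  ∑ i ∈ Finset.range k, (Bᵀ) ^ i * (Hᵀ * H) * B ^ (k - 1 - i)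

/-- `X_k = Σ_{l=1}^{k−1} U_l` (so `X₁ = 0`). -/
noncomputable def Xmat (B : Matrix (Fin nu) (Fin nu) ℝ) (H : Matrix (Fin nf) (Fin nu) ℝ)
    (k : ℕ) : Matrix (Fin nu) (Fin nu) ℝ :=
  ∑ l ∈ Finset.Ico 1 k, Umat B H l

lemma Umat_succ (B : Matrix (Fin nu) (Fin nu) ℝ) (H : Matrix (Fin nf) (Fin nu) ℝ) (k : ℕ) :
    Umat B H (k + 1) = Umat B H k * B + Bᵀ ^ k * (Hᵀ * H) := by
  unfold Umat
  rw [Finset.sum_range_succ, Finset.sum_mul]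
  congr 1
  · refine Finset.sum_congr rfl fun i hi => ?_
    have hik := Finset.mem_range.mp hi
    rw [Matrix.mul_assoc _ (B ^ _) B, ← pow_succ]
    congr 2
    omega
  · simp

lemma Xmat_succ (B : Matrix (Fin nu) (Fin nu) ℝ) (H : Matrix (Fin nf) (Fin nu) ℝ) (k : ℕ) :
    Xmat B H (k + 1) = Xmat B H k + Umat B H k := by
  unfold Xmat
  rcases k.eq_zero_or_pos with rfl | hk
  · simp [Umat]
  · exact Finset.sum_Ico_succ_top hk _

lemma Tmat_transpose (B : Matrix (Fin nu) (Fin nu) ℝ) (k : ℕ) :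
    (Tmat B k)ᵀ = ∑ i ∈ Finset.range k, Bᵀ ^ i := by
  simp [Tmat, Matrix.transpose_sum, Matrix.transpose_pow]

lemma Umat_add_Xmat_sub (B : Matrix (Fin nu) (Fin nu) ℝ) (H : Matrix (Fin nf) (Fin nu) ℝ)
    (k : ℕ) :
    Umat B H k + Xmat B H k - Xmat B H k * B = (Tmat B k)ᵀ * (Hᵀ * H) := by
  rw [Tmat_transpose]
  induction k with
  | zero => simp [Umat, Xmat]
  | succ k ih =>
    rw [Finset.sum_range_succ, Matrix.add_mul, ← ih, Umat_succ, Xmat_succ, Matrix.add_mul]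
    abel

lemma Umat_transpose (B : Matrix (Fin nu) (Fin nu) ℝ) (H : Matrix (Fin nf) (Fin nu) ℝ)
    (k : ℕ) : (Umat B H k)ᵀ = Umat B H k := by
  unfold Umat
  rw [Matrix.transpose_sum, ← Finset.sum_range_reflect]
  refine Finset.sum_congr rfl fun i hi => ?_
  have hik := Finset.mem_range.mp hi
  have hsub : k - 1 - (k - 1 - i) = i := by omega
  simp only [hsub, Matrix.transpose_mul, Matrix.transpose_pow, Matrix.transpose_transpose,
    Matrix.mul_assoc]

lemma Xmat_transpose (B : Matrix (Fin nu) (Fin nu) ℝ) (H : Matrix (Fin nf) (Fin nu) ℝ)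
    (k : ℕ) : (Xmat B H k)ᵀ = Xmat B H k := by
  simp only [Xmat, Matrix.transpose_sum, Umat_transpose]

/-- `U_k T_k − X_k B^k + X_k = T_kᵀ HᵀH T_k`, and `U_k`, `X_k` are
symmetric, for every `k ≥ 1`. -/
theorem TUX_identity
    (B : Matrix (Fin nu) (Fin nu) ℝ) (H : Matrix (Fin nf) (Fin nu) ℝ)
    (k : ℕ) (hk : 1 ≤ k) :
    Umat B H k * Tmat B k - Xmat B H k * B ^ k + Xmat B H k
        = (Tmat B k)ᵀ * (Hᵀ * H) * Tmat B k ∧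
      (Umat B H k)ᵀ = Umat B H k ∧ (Xmat B H k)ᵀ = Xmat B H k := by
  refine ⟨?_, Umat_transpose B H k, Xmat_transpose B H k⟩
  have hgeom : (B - 1) * Tmat B k = B ^ k - 1 := mul_geom_sum B k
  have hpow : B ^ k = (B - 1) * Tmat B k + 1 := by rw [hgeom, sub_add_cancel]
  rw [← Umat_add_Xmat_sub, hpow]
  noncomm_ring
end

section
/- Let a₀, a₁, a₂ ∈ ℝ and P(z) = a₀ + a₁z + a₂z² + z³. Then every complex root of P lies strictly inside the unit circle |z| = 1 if and only if the following three conditions hold: (a₀ − 1)(a₀ + 1) < 0; (a₀² − a₂a₀ + a₁ − 1)(a₀² + a₂a₀ − a₁ − 1) > 0; and (a₀ + a₂ − a₁ − 1)(a₀ + a₂ + a₁ + 1) < 0. -/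
/-- The region of coefficients for which the real cubic `(z - r) (z² + p z + q)` is Schur stable,
described by the parameters of the factorization. -/
lemma factored_cubic_inequalities_iff (r p q : ℝ) :
    (|r| < 1 ∧ |q| < 1 ∧ |p| < 1 + q) ↔
      ((r * q) ^ 2 < 1 ∧ 0 < (1 - q) * (1 + r * p + r ^ 2 * q) ∧
        0 < (1 + q) * (1 - r ^ 2 * q) - r * p * (1 - q) ∧
        0 < (1 - r ^ 2) * ((1 + q) ^ 2 - p ^ 2)) := by
  have hr0 := abs_nonneg r
  have hp0 := abs_nonneg p
  have hrp1 : r * p ≤ |r| * |p| := by rw [← abs_mul]; exact le_abs_self _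
  have hrp2 : -(|r| * |p|) ≤ r * p := by rw [← abs_mul]; exact neg_abs_le _
  have hrp3 : r * p = |r| * |p| ∨ r * p = -(|r| * |p|) := by
    rw [← abs_mul]
    rcases abs_choice (r * p) with h | h <;> rw [h] <;> simp
  rw [← sq_abs p, mul_pow, ← sq_abs r]
  generalize r * p = t at *
  generalize |r| = s at *
  generalize |p| = u at *
  constructor
  · rintro ⟨hs, hq, hu⟩
    obtain ⟨hq1, hq2⟩ := abs_lt.mp hq
    have hsu : s * u ≤ s * (1 + q) := by gcongr
    have hsq1 : 0 < 1 - s * q := by nlinarith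
    have hsq2 : 0 < 1 + s * q := by nlinarith
    refine ⟨by nlinarith [mul_pos hsq1 hsq2], mul_pos (by linarith) ?_, ?_, ?_⟩
    · nlinarith [mul_pos (sub_pos.mpr hs) hsq1]
    · have h1 : t * (1 - q) ≤ s * (1 + q) * (1 - q) :=
        mul_le_mul_of_nonneg_right (by linarith) (by linarith)
      have h2 : 0 < (1 + q) * ((1 - s) * (1 + s * q)) :=
        mul_pos (by linarith) (mul_pos (by linarith) hsq2)
      nlinarith
    · exact mul_pos (by nlinarith) (by nlinarith)
  · rintro ⟨h1, h2, h3, h4⟩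
    obtain ⟨hsq1, hsq2⟩ := abs_lt.mp ((sq_lt_one_iff_abs_lt_one (s * q)).mp (by rwa [mul_pow]))
    rcases lt_trichotomy s 1 with hs | hs | hs
    · have hpq : u ^ 2 < (1 + q) ^ 2 := by
        have := pos_of_mul_pos_right h4 (by nlinarith)
        linarith
      have hq1 : -1 < q := by
        by_contra! hq
        have hu : u ≤ -(1 + q) := by nlinarith
        have hsu : s * u ≤ s * -(1 + q) := by gcongr
        have h5 : s * (1 + q) * (1 - q) ≤ t * (1 - q) :=
          mul_le_mul_of_nonneg_right (by linarith) (by linarith)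
        have h6 : 0 ≤ -(1 + q) * ((1 - s) * (1 + s * q)) :=
          mul_nonneg (by linarith) (mul_nonneg (by linarith) (by linarith))
        nlinarith
      have hu : u < 1 + q := lt_of_pow_lt_pow_left₀ 2 (by linarith) hpq
      refine ⟨hs, abs_lt.mpr ⟨hq1, ?_⟩, hu⟩
      by_contra! hq
      have hsu : s * u ≤ s * (1 + q) := by gcongr
      have h5 : 0 < (1 - s) * (1 - s * q) := mul_pos (by linarith) (by linarith)
      nlinarith
    · subst hs
      norm_num at h4
    · exfalso
      have hq : |q| < 1 := by
        rw [abs_lt]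
        constructor <;> nlinarith
      obtain ⟨hq1, hq2⟩ := abs_lt.mp hq
      have hpq : 1 + q < u := by
        have := neg_of_mul_pos_right h4 (by nlinarith)
        nlinarith
      have hsu : s * (1 + q) < s * u := by gcongr
      rcases hrp3 with ht | ht
      · have h5 : s * (1 + q) * (1 - q) < t * (1 - q) :=
          mul_lt_mul_of_pos_right (by linarith) (by linarith)
        have h6 : 0 < (1 + q) * ((s - 1) * (1 + s * q)) :=
          mul_pos (by linarith) (mul_pos (by linarith) (by linarith))
        nlinarith
      · have h5 := pos_of_mul_pos_right h2 (by linarith)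
        have h6 : 0 < (s - 1) * (1 - s * q) := mul_pos (by linarith) (by linarith)
        nlinarith

/-- Jury criterion for a monic real quadratic. -/
lemma quadratic_roots_in_unit_disk_iff (p q : ℝ) :
    (∀ z : ℂ, z ^ 2 + p * z + q = 0 → ‖z‖ < 1) ↔ |q| < 1 ∧ |p| < 1 + q := by
  constructor
  · intro h
    rcases le_or_gt 0 (p ^ 2 - 4 * q) with hD | hD
    · have hs := Real.sq_sqrt hD
      have hreal : ∀ x : ℝ, x ^ 2 + p * x + q = 0 → |x| < 1 := fun x hx => by
        have := h x (by exact_mod_cast hx)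
        rwa [Complex.norm_real] at this
      have h1 := abs_lt.mp (hreal ((-p + √(p ^ 2 - 4 * q)) / 2) (by nlinarith))
      have h2 := abs_lt.mp (hreal ((-p - √(p ^ 2 - 4 * q)) / 2) (by nlinarith))
      generalize √(p ^ 2 - 4 * q) = d at *
      rw [abs_lt, abs_lt]
      refine ⟨⟨?_, ?_⟩, ?_, ?_⟩ <;>
        nlinarith [mul_pos (sub_pos.mpr h1.1) (sub_pos.mpr h2.1),
          mul_pos (sub_pos.mpr h1.2) (sub_pos.mpr h2.2),
          mul_pos (sub_pos.mpr h1.1) (sub_pos.mpr h2.2),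
          mul_pos (sub_pos.mpr h1.2) (sub_pos.mpr h2.1)]
    · have hs := Real.sq_sqrt (neg_pos.mpr hD).le
      generalize √(-(p ^ 2 - 4 * q)) = d at hs
      have hz := h ⟨-p / 2, d / 2⟩ (by
        apply Complex.ext
        · simp [pow_two]
          nlinarith
        · simp [pow_two]
          ring)
      rw [← sq_lt_one_iff₀ (norm_nonneg _), Complex.sq_norm, Complex.normSq_mk] at hz
      have hq : q < 1 := by nlinarith
      have hq0 : 0 < q := by nlinarith [sq_nonneg p]
      refine ⟨abs_lt.mpr ⟨by linarith, hq⟩, abs_lt_of_sq_lt_sq ?_ (by linarith)⟩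
      nlinarith [sq_nonneg (1 - q)]
  · rintro ⟨hq, hp⟩ z hz
    rw [abs_lt] at hq hp
    rw [← sq_lt_one_iff₀ (norm_nonneg _), Complex.sq_norm, Complex.normSq_apply]
    have hre := congrArg Complex.re hz
    have him := congrArg Complex.im hz
    simp [pow_two] at hre him
    generalize z.re = x at *
    generalize z.im = y at *
    have hy : y * (2 * x + p) = 0 := by linarith
    rcases mul_eq_zero.mp hy with rfl | hx
    · have hx1 : x < 1 := by nlinarith
      have hx2 : -1 < x := by nlinarith
      nlinarith
    · obtain rfl : p = -2 * x := by linarith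
      nlinarith

/-- Every monic real cubic has a real root. -/
lemma exists_real_root_of_cubic (a₀ a₁ a₂ : ℝ) :
    ∃ r : ℝ, a₀ + a₁ * r + a₂ * r ^ 2 + r ^ 3 = 0 := by
  set M := 1 + |a₀| + |a₁| + |a₂| with hM
  have h0 := abs_nonneg a₀
  have h1 := abs_nonneg a₁
  have h2 := abs_nonneg a₂
  have hM1 : 1 ≤ M := by linarith
  have hM2 : M ≤ M ^ 2 := by nlinarith
  have b0 : |a₀| ≤ |a₀| * M ^ 2 := by nlinarith
  have b1 : |a₁| * M ≤ |a₁| * M ^ 2 := by gcongr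
  have e : M ^ 3 = M ^ 2 + |a₀| * M ^ 2 + |a₁| * M ^ 2 + |a₂| * M ^ 2 := by
    rw [pow_succ M 2]
    nth_rewrite 2 [hM]
    ring
  have c1 : |a₁ * M| = |a₁| * M := by rw [abs_mul, abs_of_pos (by linarith : 0 < M)]
  have c2 : |a₂ * M ^ 2| = |a₂| * M ^ 2 := by rw [abs_mul, abs_of_nonneg (sq_nonneg M)]
  have d0 := abs_le.mp (le_refl |a₀|)
  have d1 := abs_le.mp c1.le
  have d2 := abs_le.mp c2.le
  have hc : ContinuousOn (fun r : ℝ => a₀ + a₁ * r + a₂ * r ^ 2 + r ^ 3) (Set.Icc (-M) M) := by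
    fun_prop
  obtain ⟨r, -, hr⟩ := intermediate_value_Icc (by linarith) hc
    (show (0 : ℝ) ∈ Set.Icc _ _ from ⟨by nlinarith, by nlinarith⟩)
  exact ⟨r, hr⟩

/-- Jury–Marden criterion for a monic real cubic: all complex roots of
`P(z) = a₀ + a₁z + a₂z² + z³` lie strictly inside the unit circle iff the three stated
inequalities hold. -/
theorem cubic_roots_in_unit_disk_iff (a₀ a₁ a₂ : ℝ) :
    (∀ z : ℂ, (a₀ : ℂ) + (a₁ : ℂ) * z + (a₂ : ℂ) * z ^ 2 + z ^ 3 = 0 → ‖z‖ < 1) ↔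
      ((a₀ - 1) * (a₀ + 1) < 0 ∧
        (a₀ ^ 2 - a₂ * a₀ + a₁ - 1) * (a₀ ^ 2 + a₂ * a₀ - a₁ - 1) > 0 ∧
        (a₀ + a₂ - a₁ - 1) * (a₀ + a₂ + a₁ + 1) < 0) := by
  obtain ⟨r, hr⟩ := exists_real_root_of_cubic a₀ a₁ a₂
  obtain ⟨p, rfl⟩ : ∃ p, a₂ = p - r := ⟨a₂ + r, by ring⟩
  obtain ⟨q, rfl⟩ : ∃ q, a₁ = q - r * p := ⟨a₁ + r * p, by ring⟩
  obtain rfl : a₀ = -(r * q) := by linarith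
  have hroots : (∀ z : ℂ, ((-(r * q) : ℝ) : ℂ) + ((q - r * p : ℝ) : ℂ) * z +
      ((p - r : ℝ) : ℂ) * z ^ 2 + z ^ 3 = 0 → ‖z‖ < 1) ↔
      |r| < 1 ∧ ∀ z : ℂ, z ^ 2 + p * z + q = 0 → ‖z‖ < 1 := by
    have hfac (z : ℂ) : ((-(r * q) : ℝ) : ℂ) + ((q - r * p : ℝ) : ℂ) * z +
        ((p - r : ℝ) : ℂ) * z ^ 2 + z ^ 3 = (z - r) * (z ^ 2 + p * z + q) := by
      push_cast
      ring
    simp only [hfac, mul_eq_zero, or_imp, forall_and, sub_eq_zero, forall_eq, Complex.norm_real,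
      Real.norm_eq_abs]
  rw [hroots, quadratic_roots_in_unit_disk_iff, factored_cubic_inequalities_iff]
  constructor
  · rintro ⟨h1, h2, h3, h4⟩
    exact ⟨by linarith, by linarith [mul_pos h2 h3], by linarith⟩
  · rintro ⟨h1, h2, h3⟩
    have h5 : 0 < ((1 - q) * (1 + r * p + r ^ 2 * q)) *
        ((1 + q) * (1 - r ^ 2 * q) - r * p * (1 - q)) := by linarith
    refine ⟨by linarith, ?_, ?_, by linarith⟩ <;>
      rcases pos_and_pos_or_neg_and_neg_of_mul_pos h5 with h | h <;> linarith [h.1, h.2]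
end
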